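/- Let E ⊆ ℝ^N be a bounded measurable set with |E| = 1, barycenter at the origin, and essential diameter at most D. Then there exists a constant C₁ depending only on N (one may take C₁ = C_F(N)(ω_{N−1}/ω_N^{(N−1)/N} + ω_N^{1/N}/2), where C_F(N) is the constant in the sharp quantitative isoperimetric inequality) such that ε := | 1/2 − |E ∩ {x₁>0}| | ≤ C₁ D √δ(E), where δ(E) = (P(E) − P(B))/P(B) is the isoperimetric deficit and B the unit-volume ball. -/

import Mathlib

open MeasureTheory Metric Set ENNReal

noncomputable section

abbrev En (N : ℕ) := EuclideanSpace ℝ (Fin N)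

/-- The volume of the unit ball in `ℝ^N`. -/
def omegaB (N : ℕ) : ℝ := (volume (Metric.ball (0 : En N) 1)).toReal

/-- The divergence of a vector field on `ℝ^N`. -/
def divg {N : ℕ} (φ : En N → En N) (x : En N) : ℝ :=
  ∑ i, fderiv ℝ φ x (EuclideanSpace.single i (1 : ℝ)) i

/-- The set of candidate values in the sup defining the distributional perimeter of `E`. -/
def perSet {N : ℕ} (E : Set (En N)) : Set ℝ :=
  {p | ∃ φ : En N → En N, ContDiff ℝ 1 φ ∧ HasCompactSupport φ ∧
    (∀ x, ‖φ x‖ ≤ 1) ∧ p = ∫ x in E, divg φ x}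

/-- The distributional (De Giorgi) perimeter of `E`. -/
def perimeter {N : ℕ} (E : Set (En N)) : ℝ := sSup (perSet E)

/-- `E` has finite perimeter. -/
def HasFinitePerimeter {N : ℕ} (E : Set (En N)) : Prop := BddAbove (perSet E)

/-- The essential diameter of `E`. -/
def essDiam {N : ℕ} (E : Set (En N)) : ℝ≥0∞ :=
  sInf {d : ℝ≥0∞ |
    (volume.prod volume) {p : En N × En N | p.1 ∈ E ∧ p.2 ∈ E ∧ d < edist p.1 p.2} = 0}

/-- The barycenter of `E`. -/
def bary {N : ℕ} (E : Set (En N)) : En N := ((volume E).toReal)⁻¹ • ∫ x in E, x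

/-- The radius of the ball having the same volume as `E`. -/
def ballRad {N : ℕ} (E : Set (En N)) : ℝ := ((volume E).toReal / omegaB N) ^ (1 / (N : ℝ))

/-- The barycentric asymmetry `λ₀(E)`. -/
def lam0 {N : ℕ} (E : Set (En N)) : ℝ :=
  (volume (symmDiff E (Metric.ball (bary E) (ballRad E)))).toReal / (volume E).toReal

/-- The Fraenkel asymmetry `λ(E)`. -/
def fraenkel {N : ℕ} (E : Set (En N)) : ℝ :=
  ⨅ y : En N, (volume (symmDiff E (Metric.ball y (ballRad E)))).toReal / (volume E).toReal

/-- The isoperimetric deficit `δ(E)`. -/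
def deficit {N : ℕ} (E : Set (En N)) : ℝ :=
  (perimeter E - perimeter (Metric.ball (0 : En N) (ballRad E))) /
    perimeter (Metric.ball (0 : En N) (ballRad E))

/-- Measure-theoretic connectedness. -/
def MConnected {N : ℕ} (E : Set (En N)) : Prop :=
  ∀ F : Set (En N), MeasurableSet F → F ⊆ E → 0 < volume F → volume F < volume E →
    perimeter E < perimeter F + perimeter (E \ F)

/-- Steiner symmetrization of a subset of `ℝ^ι` in the `i`-th coordinate direction. -/
def steiner {ι : Type*} [DecidableEq ι] (i : ι) (A : Set (ι → ℝ)) : Set (ι → ℝ) :=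
  {x | ENNReal.ofReal (2 * |x i|) < volume {t : ℝ | Function.update x i t ∈ A}}

lemma volume_add_volume_le {S T : Set ℝ} (hS : S.Nonempty) (hT : T.Nonempty) {l : ℝ}
    (h : ∀ s ∈ S, ∀ t ∈ T, |s - t| ≤ l) : volume S + volume T ≤ ENNReal.ofReal (2 * l) := by
  obtain ⟨s₀, hs₀⟩ := hS
  obtain ⟨t₀, ht₀⟩ := hT
  have hSa : BddAbove S := ⟨t₀ + l, fun s hs => by linarith [(abs_le.1 (h s hs t₀ ht₀)).2]⟩
  have hSb : BddBelow S := ⟨t₀ - l, fun s hs => by linarith [(abs_le.1 (h s hs t₀ ht₀)).1]⟩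
  have hTa : BddAbove T := ⟨s₀ + l, fun t ht => by linarith [(abs_le.1 (h s₀ hs₀ t ht)).1]⟩
  have hTb : BddBelow T := ⟨s₀ - l, fun t ht => by linarith [(abs_le.1 (h s₀ hs₀ t ht)).2]⟩
  have h1 : sSup S ≤ sInf T + l := csSup_le ⟨s₀, hs₀⟩ fun s hs => by
    have : s - l ≤ sInf T := le_csInf ⟨t₀, ht₀⟩ fun t ht => by
      linarith [(abs_le.1 (h s hs t ht)).2]
    linarith
  have h2 : sSup T ≤ sInf S + l := csSup_le ⟨t₀, ht₀⟩ fun t ht => by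
    have : t - l ≤ sInf S := le_csInf ⟨s₀, hs₀⟩ fun s hs => by
      linarith [(abs_le.1 (h s hs t ht)).1]
    linarith
  have hS' : sInf S ≤ sSup S := (csInf_le hSb hs₀).trans (le_csSup hSa hs₀)
  have hT' : sInf T ≤ sSup T := (csInf_le hTb ht₀).trans (le_csSup hTa ht₀)
  calc volume S + volume T
      ≤ volume (Icc (sInf S) (sSup S)) + volume (Icc (sInf T) (sSup T)) :=
        add_le_add (measure_mono (subset_Icc_csInf_csSup hSb hSa))
          (measure_mono (subset_Icc_csInf_csSup hTb hTa))
    _ = ENNReal.ofReal ((sSup S - sInf S) + (sSup T - sInf T)) := by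
        rw [Real.volume_Icc, Real.volume_Icc, ENNReal.ofReal_add (by linarith) (by linarith)]
    _ ≤ ENNReal.ofReal (2 * l) := ENNReal.ofReal_le_ofReal (by linarith)

lemma volume_setOf_ofReal_two_mul_abs_lt (v : ℝ≥0∞) :
    volume {t : ℝ | ENNReal.ofReal (2 * |t|) < v} = v := by
  induction v with
  | top => simp [ENNReal.mul_lt_top]
  | coe v =>
    have : {t : ℝ | ENNReal.ofReal (2 * |t|) < v} = Ioo (-(v / 2 : ℝ)) (v / 2 : ℝ) := by
      ext t
      rw [mem_ofPred_eq, ← ENNReal.ofReal_coe_nnreal,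
        ENNReal.ofReal_lt_ofReal_iff_of_nonneg (by positivity), mem_Ioo, ← abs_lt]
      constructor <;> intro h <;> linarith
    rw [this, Real.volume_Ioo, sub_neg_eq_add, add_halves, ENNReal.ofReal_coe_nnreal]

section Steiner

variable {ι : Type*} [DecidableEq ι] {i j : ι} {A : Set (ι → ℝ)}

lemma update_mem_steiner (x : ι → ℝ) (t : ℝ) : Function.update x i t ∈ steiner i A ↔
    ENNReal.ofReal (2 * |t|) < volume {t : ℝ | Function.update x i t ∈ A} := by
  simp [steiner]

lemma steiner_reflect_self {x : ι → ℝ} (hx : x ∈ steiner i A) :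
    Function.update x i (-x i) ∈ steiner i A := by
  rw [update_mem_steiner, abs_neg]
  exact hx

lemma steiner_reflect_of_ne (hij : j ≠ i)
    (hA : ∀ x ∈ A, Function.update x j (-x j) ∈ A) {x : ι → ℝ} (hx : x ∈ steiner i A) :
    Function.update x j (-x j) ∈ steiner i A := by
  refine lt_of_lt_of_le (b := volume {t : ℝ | Function.update x i t ∈ A}) ?_
    (measure_mono fun t ht => ?_)
  · rw [Function.update_of_ne hij.symm]
    exact hx
  · have := hA _ ht
    rw [Function.update_of_ne hij, Function.update_comm hij.symm] at this
    exact this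

lemma measurableSet_steiner (hA : MeasurableSet A) : MeasurableSet (steiner i A) := by
  have h : Measurable fun x : ι → ℝ => volume {t : ℝ | Function.update x i t ∈ A} := by
    have hs : MeasurableSet {p : (ι → ℝ) × ℝ | Function.update p.1 i p.2 ∈ A} := by
      have : Measurable fun p : (ι → ℝ) × ℝ => Function.update p.1 i p.2 := by
        fun_prop
      exact this hA
    exact measurable_measure_prodMk_left hs
  exact measurableSet_lt (by fun_prop) h

variable [Fintype ι]

lemma volume_steiner (hA : MeasurableSet A) : volume (steiner i A) = volume A := by
  rw [← lintegral_indicator_one hA, ← lintegral_indicator_one (measurableSet_steiner hA)]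
  refine lintegral_eq_of_lmarginal_eq (μ := fun _ => volume) {i}
    (measurable_one.indicator (measurableSet_steiner hA)) (measurable_one.indicator hA) ?_
  rw [lmarginal_singleton, lmarginal_singleton]
  ext x
  have key : ∀ B : Set (ι → ℝ), MeasurableSet B →
      ∫⁻ t, B.indicator (1 : (ι → ℝ) → ℝ≥0∞) (Function.update x i t)
        = volume {t : ℝ | Function.update x i t ∈ B} := fun B hB => by
    exact lintegral_indicator_one (s := {t : ℝ | Function.update x i t ∈ B})
      (measurable_update x hB)
  rw [key _ hA, key _ (measurableSet_steiner hA)]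
  simp_rw [update_mem_steiner]
  exact volume_setOf_ofReal_two_mul_abs_lt _

lemma sum_sq_sub_steiner_le {d : ℝ} (hA : ∀ x ∈ A, ∀ y ∈ A, ∑ k, (x k - y k) ^ 2 ≤ d)
    {x y : ι → ℝ} (hx : x ∈ steiner i A) (hy : y ∈ steiner i A) :
    ∑ k, (x k - y k) ^ 2 ≤ d := by
  have hS := nonempty_of_measure_ne_zero (bot_lt_iff_ne_bot.1 (bot_le.trans_lt hx))
  have hT := nonempty_of_measure_ne_zero (bot_lt_iff_ne_bot.1 (bot_le.trans_lt hy))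
  set R := ∑ k ∈ Finset.univ.erase i, (x k - y k) ^ 2 with hR
  have key : ∀ s ∈ {t : ℝ | Function.update x i t ∈ A},
      ∀ t ∈ {t : ℝ | Function.update y i t ∈ A}, R + (s - t) ^ 2 ≤ d := fun s hs t ht => by
    have := hA _ hs _ ht
    rw [← Finset.sum_erase_add _ _ (Finset.mem_univ i)] at this
    simp only [Function.update_self] at this
    convert this using 2
    refine Finset.sum_congr rfl fun k hk => ?_
    rw [Function.update_of_ne (Finset.ne_of_mem_erase hk),
      Function.update_of_ne (Finset.ne_of_mem_erase hk)]
  have hdR : 0 ≤ d - R := by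
    obtain ⟨s, hs⟩ := hS
    obtain ⟨t, ht⟩ := hT
    nlinarith [key s hs t ht, sq_nonneg (s - t)]
  have hvol := volume_add_volume_le hS hT (l := Real.sqrt (d - R)) fun s hs t ht =>
    Real.abs_le_sqrt (by linarith [key s hs t ht])
  have hlt := (ENNReal.add_lt_add hx hy).le.trans hvol
  rw [← ENNReal.ofReal_add (by positivity) (by positivity),
    ENNReal.ofReal_le_ofReal_iff (by positivity)] at hlt
  have habs : |x i - y i| ≤ Real.sqrt (d - R) := by
    linarith [abs_sub (x i) (y i)]
  rw [← Finset.sum_erase_add _ _ (Finset.mem_univ i), ← hR]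
  have := (Real.le_sqrt (abs_nonneg _) hdR).1 habs
  rw [sq_abs] at this
  linarith

lemma exists_reflect_symmetric {d : ℝ} (hAm : MeasurableSet A)
    (hA : ∀ x ∈ A, ∀ y ∈ A, ∑ k, (x k - y k) ^ 2 ≤ d) (s : Finset ι) :
    ∃ B : Set (ι → ℝ), MeasurableSet B ∧ volume B = volume A ∧
      (∀ x ∈ B, ∀ y ∈ B, ∑ k, (x k - y k) ^ 2 ≤ d) ∧
      ∀ k ∈ s, ∀ x ∈ B, Function.update x k (-x k) ∈ B := by
  induction s using Finset.induction_on with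
  | empty => exact ⟨A, hAm, rfl, hA, by simp⟩
  | insert i s _ ih =>
    obtain ⟨B, hBm, hBv, hBd, hBs⟩ := ih
    refine ⟨steiner i B, measurableSet_steiner hBm, (volume_steiner hBm).trans hBv,
      fun x hx y hy => sum_sq_sub_steiner_le hBd hx hy, fun k hk x hx => ?_⟩
    rcases eq_or_ne k i with rfl | hki
    · exact steiner_reflect_self hx
    · exact steiner_reflect_of_ne hki (hBs k (Finset.mem_of_mem_insert_of_ne hk hki)) hx

lemma neg_mem_of_reflect_symmetric {B : Set (ι → ℝ)}
    (hB : ∀ k, ∀ x ∈ B, Function.update x k (-x k) ∈ B) {x : ι → ℝ} (hx : x ∈ B) : -x ∈ B := by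
  have key : ∀ s : Finset ι, (fun k => if k ∈ s then -x k else x k) ∈ B := fun s => by
    induction s using Finset.induction_on with
    | empty => simpa using hx
    | insert i s his ih =>
      convert hB i _ ih using 1
      ext k
      rcases eq_or_ne k i with rfl | hki
      · simp [his]
      · simp [hki]
  convert key Finset.univ using 1
  ext k
  simp

end Steiner

/-- The isodiametric inequality for measurable subsets of Euclidean space. -/
lemma volume_le_volume_closedBall_half_diam {N : ℕ} {A : Set (En N)} (hAm : MeasurableSet A)
    {D : ℝ} (hD : 0 ≤ D) (hA : ∀ x ∈ A, ∀ y ∈ A, dist x y ≤ D) :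
    volume A ≤ volume (closedBall (0 : En N) (D / 2)) := by
  have hp := PiLp.volume_preserving_toLp (Fin N)
  obtain ⟨B, hBm, hBv, hBd, hBs⟩ := exists_reflect_symmetric (d := D ^ 2) (hp.measurable hAm)
    (fun x hx y hy => by
      have := hA _ hx _ hy
      rw [EuclideanSpace.dist_eq, Real.sqrt_le_left hD] at this
      simpa [Real.dist_eq, sq_abs] using this) Finset.univ
  rw [hp.measure_preimage hAm.nullMeasurableSet] at hBv
  rw [← hBv, ← hp.measure_preimage measurableSet_closedBall.nullMeasurableSet]
  refine measure_mono fun x hx => ?_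
  have h := hBd x hx _ (neg_mem_of_reflect_symmetric (fun k => hBs k (Finset.mem_univ k)) hx)
  have h4 : ∑ k, (x k - (-x) k) ^ 2 = 4 * ∑ k, x k ^ 2 := by
    rw [Finset.mul_sum]
    refine Finset.sum_congr rfl fun k _ => ?_
    simp only [Pi.neg_apply]
    ring
  rw [h4] at h
  rw [mem_preimage, mem_closedBall_zero_iff, EuclideanSpace.norm_eq,
    Real.sqrt_le_left (by positivity)]
  simp only [Real.norm_eq_abs, sq_abs]
  linarith

lemma exists_ae_eq_edist_le_essDiam {N : ℕ} {E : Set (En N)} (hE : MeasurableSet E) :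
    ∃ A : Set (En N), MeasurableSet A ∧ A =ᵐ[volume] E ∧
      ∀ x ∈ A, ∀ y ∈ A, edist x y ≤ essDiam E := by
  have hS : MeasurableSet (volume.restrict E).support := Measure.isClosed_support.measurableSet
  refine ⟨E ∩ (volume.restrict E).support, hE.inter hS, ?_, ?_⟩
  · have h : (volume.restrict E) (volume.restrict E).supportᶜ = 0 :=
      Measure.measure_compl_support
    rw [Measure.restrict_apply hS.compl] at h
    refine inter_subset_left.eventuallyLE.antisymm (ae_le_set.2 ?_)
    rw [sdiff_self_inter, ← h]
    congr 1
    ext x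
    simp [and_comm]
  · rintro x ⟨-, hx⟩ y ⟨-, hy⟩
    refine le_sInf fun d hd => ?_
    by_contra! hlt
    have hopen : IsOpen {p : En N × En N | d < edist p.1 p.2} :=
      isOpen_lt continuous_const (by fun_prop)
    obtain ⟨u, v, hu, hv, hxu, hyv, huv⟩ := isOpen_prod_iff.1 hopen x y hlt
    have hpu := (Measure.mem_support_iff_forall x).1 hx u (hu.mem_nhds hxu)
    have hpv := (Measure.mem_support_iff_forall y).1 hy v (hv.mem_nhds hyv)
    rw [Measure.restrict_apply hu.measurableSet] at hpu
    rw [Measure.restrict_apply hv.measurableSet] at hpv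
    have hsub : (u ∩ E) ×ˢ (v ∩ E) ⊆
        {p : En N × En N | p.1 ∈ E ∧ p.2 ∈ E ∧ d < edist p.1 p.2} := fun p hp =>
      ⟨hp.1.2, hp.2.2, huv ⟨hp.1.1, hp.2.1⟩⟩
    have h0 := measure_mono_null hsub hd
    rw [Measure.prod_prod, mul_eq_zero] at h0
    exact h0.elim hpu.ne' hpv.ne'

lemma volumeReal_ball_eq {N : ℕ} (y : En N) {r : ℝ} (hr : 0 < r) :
    volume.real (ball y r) = r ^ N * omegaB N := by
  rw [Measure.real, Measure.addHaar_ball_of_pos _ _ hr, ENNReal.toReal_mul,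
    ENNReal.toReal_ofReal (by positivity), finrank_euclideanSpace_fin]
  rfl

lemma volumeReal_ball_inter_slab_le {n : ℕ} {r : ℝ} (hr : 0 < r) {c : ℝ} (hc : 0 ≤ c) :
    volume.real (ball (0 : En (n + 1)) r ∩ {x | |x 0| ≤ c}) ≤ 2 * c * (r ^ n * omegaB n) := by
  let f : En (n + 1) → ℝ × En n := fun x => (x 0, WithLp.toLp 2 fun j => x (Fin.succ j))
  have hf : MeasurePreserving f volume (volume.prod volume) := by
    have h1 := PiLp.volume_preserving_ofLp (Fin (n + 1))
    have h2 := volume_preserving_piFinSuccAbove (fun _ : Fin (n + 1) => ℝ) 0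
    have h3 := (MeasurePreserving.id (volume : Measure ℝ)).prod (PiLp.volume_preserving_toLp (Fin n))
    exact (h3.comp h2).comp h1
  have hsub : ball (0 : En (n + 1)) r ∩ {x | |x 0| ≤ c} ⊆
      f ⁻¹' (Icc (-c) c ×ˢ ball (0 : En n) r) := by
    rintro x ⟨hx, hxc⟩
    refine ⟨abs_le.1 hxc, ?_⟩
    rw [mem_ball_zero_iff] at hx ⊢
    refine lt_of_le_of_lt ?_ hx
    rw [EuclideanSpace.norm_eq, EuclideanSpace.norm_eq]
    refine Real.sqrt_le_sqrt ?_
    rw [Fin.sum_univ_succ]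
    simp only [f]
    exact le_add_of_nonneg_left (sq_nonneg _)
  have hpre : volume (f ⁻¹' (Icc (-c) c ×ˢ ball (0 : En n) r))
      = volume (Icc (-c) c) * volume (ball (0 : En n) r) := by
    rw [hf.measure_preimage (measurableSet_Icc.prod measurableSet_ball).nullMeasurableSet,
      Measure.prod_prod]
  calc volume.real (ball (0 : En (n + 1)) r ∩ {x | |x 0| ≤ c})
      ≤ volume.real (f ⁻¹' (Icc (-c) c ×ˢ ball (0 : En n) r)) := by
        refine measureReal_mono hsub ?_
        rw [hpre]
        exact ENNReal.mul_ne_top (by simp) measure_ball_lt_top.ne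
    _ = 2 * c * (r ^ n * omegaB n) := by
        rw [Measure.real, hpre, ENNReal.toReal_mul, ← volumeReal_ball_eq 0 hr, Real.volume_Icc,
          ENNReal.toReal_ofReal (by linarith), Measure.real]
        ring

lemma abs_half_sub_volumeReal_ball_inter_le {N : ℕ} {i : Fin N} {r s : ℝ}
    (hball : volume.real (ball (0 : En N) r) = 1)
    (hslab : ∀ c, 0 ≤ c → volume.real (ball (0 : En N) r ∩ {x | |x i| ≤ c}) ≤ 2 * c * s)
    (y : En N) :
    |1 / 2 - volume.real (ball y r ∩ {x | 0 < x i})| ≤ |y i| * s := by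
  set c := |y i| with hc
  have hfin : ∀ T : Set (En N), volume (ball (0 : En N) r ∩ T) ≠ ⊤ := fun T =>
    ((measure_mono inter_subset_left).trans_lt measure_ball_lt_top).ne
  have htrans : volume.real (ball y r ∩ {x | 0 < x i})
      = volume.real (ball (0 : En N) r ∩ {x | -y i < x i}) := by
    rw [← (measurePreserving_sub_right volume y).measureReal_preimage
      (s := ball (0 : En N) r ∩ {x | -y i < x i})
      (measurableSet_ball.inter (measurableSet_lt (by fun_prop) (by fun_prop))).nullMeasurableSet]
    congr 1
    ext x
    simp [dist_eq_norm]
  have hrefl : volume.real (ball (0 : En N) r ∩ {x | x i < -c})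
      = volume.real (ball (0 : En N) r ∩ {x | c < x i}) := by
    rw [← (Measure.measurePreserving_neg volume).measureReal_preimage
      (measurableSet_ball.inter (measurableSet_lt (by fun_prop) (by fun_prop))).nullMeasurableSet]
    congr 1
    ext x
    simp
  have hsplit : ball (0 : En N) r = (ball (0 : En N) r ∩ {x | c < x i}) ∪
      ((ball (0 : En N) r ∩ {x | x i < -c}) ∪ (ball (0 : En N) r ∩ {x | |x i| ≤ c})) := by
    rw [← inter_union_distrib_left, ← inter_union_distrib_left, eq_comm, inter_eq_left]
    intro x _
    by_cases h1 : c < x i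
    · exact Or.inl h1
    · by_cases h2 : x i < -c
      · exact Or.inr (Or.inl h2)
      · exact Or.inr (Or.inr (abs_le.2 ⟨not_lt.1 h2, not_lt.1 h1⟩))
  have hsum : volume.real (ball (0 : En N) r ∩ {x | c < x i}) +
      (volume.real (ball (0 : En N) r ∩ {x | x i < -c}) +
        volume.real (ball (0 : En N) r ∩ {x | |x i| ≤ c})) = 1 := by
    have hm : MeasurableSet (ball (0 : En N) r ∩ {x | |x i| ≤ c}) :=
      measurableSet_ball.inter (measurableSet_le (by fun_prop) (by fun_prop))
    have hm' : MeasurableSet (ball (0 : En N) r ∩ {x | x i < -c}) :=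
      measurableSet_ball.inter (measurableSet_lt (by fun_prop) (by fun_prop))
    have hc0 : 0 ≤ c := abs_nonneg _
    rw [← measureReal_union _ hm (hfin _) (hfin _),
      ← measureReal_union _ (hm'.union hm) (hfin _) _, ← hsplit, hball]
    · rw [disjoint_left]
      rintro x ⟨-, hx⟩ (⟨-, hx'⟩ | ⟨-, hx'⟩)
      · linarith [show c < x i from hx, show x i < -c from hx']
      · linarith [show c < x i from hx, (abs_le.1 (show |x i| ≤ c from hx')).2]
    · rw [← inter_union_distrib_left]
      exact hfin _
    · rw [disjoint_left]
      rintro x ⟨-, hx⟩ ⟨-, hx'⟩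
      linarith [show x i < -c from hx, (abs_le.1 (show |x i| ≤ c from hx')).1]
  have hlo : volume.real (ball (0 : En N) r ∩ {x | c < x i})
      ≤ volume.real (ball (0 : En N) r ∩ {x | -y i < x i}) := by
    refine measureReal_mono (fun x hx => ⟨hx.1, ?_⟩) (hfin _)
    exact lt_of_le_of_lt (neg_le_abs (y i)) hx.2
  have hhi : volume.real (ball (0 : En N) r ∩ {x | -y i < x i})
      ≤ volume.real (ball (0 : En N) r ∩ {x | c < x i}) +
        volume.real (ball (0 : En N) r ∩ {x | |x i| ≤ c}) := by
    refine le_trans (measureReal_mono ?_ ?_) (measureReal_union_le _ _)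
    · rintro x ⟨hx, hxy⟩
      rcases lt_or_ge c (x i) with h | h
      · exact Or.inl ⟨hx, h⟩
      · refine Or.inr ⟨hx, abs_le.2 ⟨?_, h⟩⟩
        linarith [le_abs_self (y i), show -y i < x i from hxy]
    · rw [← inter_union_distrib_left]
      exact hfin _
  have := hslab c (abs_nonneg _)
  rw [htrans, abs_le]
  constructor <;> linarith

lemma setIntegral_ball_sub_center {N : ℕ} (i : Fin N) (y : En N) (r : ℝ) :
    ∫ x in ball y r, (x i - y i) = 0 := by
  have hf := integral_sub_left_eq_self
    ((ball y r).indicator fun x : En N => x i - y i) volume ((2 : ℝ) • y)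
  have hneg : ∀ x, (ball y r).indicator (fun x : En N => x i - y i) ((2 : ℝ) • y - x)
      = -(ball y r).indicator (fun x : En N => x i - y i) x := fun x => by
    have hmem : (2 : ℝ) • y - x ∈ ball y r ↔ x ∈ ball y r := by
      rw [mem_ball, mem_ball', dist_eq_norm, dist_eq_norm]
      congr! 2
      rw [two_smul]
      abel
    by_cases hx : x ∈ ball y r
    · rw [indicator_of_mem (hmem.2 hx), indicator_of_mem hx]
      simp
      ring
    · rw [indicator_of_notMem (mt hmem.1 hx), indicator_of_notMem hx, neg_zero]
  simp_rw [hneg] at hf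
  rw [integral_neg, integral_indicator measurableSet_ball] at hf
  linarith

lemma abs_setIntegral_sub_setIntegral_le {α : Type*} [MeasurableSpace α] {μ : Measure α}
    {A B : Set α} (hA : MeasurableSet A) (hB : MeasurableSet B) (hAf : μ A ≠ ⊤) (hBf : μ B ≠ ⊤)
    {f : α → ℝ} (hfA : IntegrableOn f A μ) (hfB : IntegrableOn f B μ) {C : ℝ}
    (hCA : ∀ x ∈ A, |f x| ≤ C) (hCB : ∀ x ∈ B, |f x| ≤ C) :
    |∫ x in B, f x ∂μ - ∫ x in A, f x ∂μ| ≤ C * μ.real (symmDiff A B) := by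
  rw [← integral_inter_add_sdiff hA hfB, ← integral_inter_add_sdiff hB hfA, inter_comm B A]
  have h1 : |∫ x in A \ B, f x ∂μ| ≤ C * μ.real (A \ B) := by
    rw [← Real.norm_eq_abs]
    exact norm_setIntegral_le_of_norm_le_const
      ((measure_mono sdiff_subset).trans_lt hAf.lt_top) fun x hx => hCA x hx.1
  have h2 : |∫ x in B \ A, f x ∂μ| ≤ C * μ.real (B \ A) := by
    rw [← Real.norm_eq_abs]
    exact norm_setIntegral_le_of_norm_le_const
      ((measure_mono sdiff_subset).trans_lt hBf.lt_top) fun x hx => hCB x hx.1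
  rw [measureReal_symmDiff_eq hA hB hAf hBf]
  rw [abs_le] at *
  constructor <;> linarith

lemma two_mul_abs_volumeReal_inter_sub_le {α : Type*} [MeasurableSpace α] {μ : Measure α}
    {A B : Set α} (hA : MeasurableSet A) (hB : MeasurableSet B) (hAf : μ A ≠ ⊤) (hBf : μ B ≠ ⊤)
    (hAB : μ.real A = μ.real B) (H : Set α) :
    2 * |μ.real (A ∩ H) - μ.real (B ∩ H)| ≤ μ.real (symmDiff A B) := by
  have hsub : ∀ S T : Set α, μ S ≠ ⊤ → μ T ≠ ⊤ → μ.real (S ∩ H) ≤ μ.real (T ∩ H) + μ.real (S \ T) :=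
    fun S T hS hT => by
      refine le_trans (measureReal_mono ?_ ?_) (measureReal_union_le _ _)
      · rintro x ⟨hx, hxH⟩
        by_cases hxT : x ∈ T
        · exact Or.inl ⟨hxT, hxH⟩
        · exact Or.inr ⟨hx, hxT⟩
      · exact (measure_union_lt_top ((measure_mono inter_subset_left).trans_lt hT.lt_top)
          ((measure_mono sdiff_subset).trans_lt hS.lt_top)).ne
  have h1 := hsub A B hAf hBf
  have h2 := hsub B A hBf hAf
  have h3 := measureReal_inter_add_sdiff (s := A) hB hAf
  have h4 := measureReal_inter_add_sdiff (s := B) hA hBf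
  rw [inter_comm B A] at h4
  rw [measureReal_symmDiff_eq hA hB hAf hBf]
  have : |μ.real (A ∩ H) - μ.real (B ∩ H)| ≤ μ.real (A \ B) := by
    rw [abs_le]
    constructor <;> linarith
  linarith

lemma abs_center_le {N : ℕ} {i : Fin N} {A : Set (En N)} (hA : MeasurableSet A)
    (hvol : volume A = 1) (hbar : ∫ x in A, x = (0 : En N)) {D : ℝ}
    (hD : ∀ x ∈ A, ∀ y ∈ A, dist x y ≤ D) {y : En N} {r : ℝ} (hrD : 2 * r ≤ D)
    (hball : volume.real (ball y r) = 1) (hne : (A ∩ ball y r).Nonempty) :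
    |y i| ≤ D * volume.real (symmDiff A (ball y r)) := by
  obtain ⟨z, hzA, hzB⟩ := hne
  have hAsub : A ⊆ closedBall z D := fun x hx => hD x hx z hzA
  have hint : ∀ {G : Type} [NormedAddCommGroup G] (g : En N → G), Continuous g →
      IntegrableOn g A ∧ IntegrableOn g (ball y r) := fun g hg =>
    ⟨(hg.continuousOn.integrableOn_compact (isCompact_closedBall z D)).mono_set hAsub,
      (hg.continuousOn.integrableOn_compact (isCompact_closedBall y r)).mono_set
        ball_subset_closedBall⟩
  have hcoord : ∀ w : En N, ‖w‖ ≤ D → |w i| ≤ D := fun w hw =>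
    (PiLp.norm_apply_le w i).trans hw
  have hA1 : volume.real A = 1 := by simp [Measure.real, hvol]
  have hAint : ∫ x in A, (x i - z i) = -z i := by
    have h0 : ∫ x in A, x i = 0 := by
      have := (EuclideanSpace.proj (𝕜 := ℝ) i).integral_comp_comm (hint (fun x : En N => x)
        continuous_id).1
      rw [hbar, map_zero] at this
      exact this
    rw [integral_sub (hint _ (by fun_prop)).1 (hint _ (by fun_prop)).1, h0, setIntegral_const, hA1]
    simp
  have hBint : ∫ x in ball y r, (x i - z i) = y i - z i := by
    have h0 := setIntegral_ball_sub_center i y r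
    rw [integral_sub (hint _ (by fun_prop)).2 (hint _ (by fun_prop)).2, setIntegral_const,
      hball, one_smul] at h0 ⊢
    linarith
  have key := abs_setIntegral_sub_setIntegral_le hA measurableSet_ball (μ := volume)
    (by simp [hvol]) measure_ball_lt_top.ne (f := fun x : En N => x i - z i) (C := D)
    (hint _ (by fun_prop)).1 (hint _ (by fun_prop)).2
    (fun x hx => hcoord (x - z) (by rw [← dist_eq_norm]; exact hD x hx z hzA))
    (fun x hx => hcoord (x - z) (by
      rw [← dist_eq_norm]
      linarith [dist_triangle_right x z y, mem_ball.1 hx, mem_ball.1 hzB]))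
  rw [hAint, hBint] at key
  simpa using key

lemma abs_half_sub_le_mul_volumeReal_symmDiff {N : ℕ} {i : Fin N} {A : Set (En N)}
    (hA : MeasurableSet A) (hvol : volume A = 1) (hbar : ∫ x in A, x = (0 : En N)) {D : ℝ}
    (hD : ∀ x ∈ A, ∀ y ∈ A, dist x y ≤ D) {r s : ℝ} (hr : 0 < r) (hrD : 2 * r ≤ D) (hs : 0 ≤ s)
    (hball : ∀ y : En N, volume.real (ball y r) = 1)
    (hslab : ∀ c, 0 ≤ c → volume.real (ball (0 : En N) r ∩ {x | |x i| ≤ c}) ≤ 2 * c * s)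
    (y : En N) :
    |1 / 2 - volume.real (A ∩ {x | 0 < x i})|
      ≤ volume.real (symmDiff A (ball y r)) * ((s + r⁻¹ / 2) * D) := by
  set a := volume.real (symmDiff A (ball y r)) with ha
  have ha0 : 0 ≤ a := measureReal_nonneg
  have hA1 : volume.real A = 1 := by simp [Measure.real, hvol]
  have hrD1 : 1 ≤ r⁻¹ / 2 * D := by
    rw [inv_eq_one_div, div_div, div_mul_eq_mul_div, one_mul, le_div_iff₀ (by positivity)]
    linarith
  have hsD : 0 ≤ s * D := mul_nonneg hs (by linarith)
  rcases (A ∩ ball y r).eq_empty_or_nonempty with hempty | hne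
  · have ha2 : a = 2 := by
      rw [ha, (disjoint_iff_inter_eq_empty.2 hempty).symmDiff_eq_sup, show A ⊔ ball y r = A ∪ ball y r from rfl,
        measureReal_union (disjoint_iff_inter_eq_empty.2 hempty) measurableSet_ball
          (by simp [hvol]) measure_ball_lt_top.ne, hA1, hball]
      norm_num
    have h0 : 0 ≤ volume.real (A ∩ {x | 0 < x i}) := measureReal_nonneg
    have h1 : volume.real (A ∩ {x | 0 < x i}) ≤ 1 :=
      (measureReal_mono inter_subset_left (by simp [hvol])).trans_eq hA1
    rw [ha2, abs_le]
    constructor <;> linarith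
  · have hy := abs_center_le (i := i) hA hvol hbar hD hrD (hball y) hne
    have hb := abs_half_sub_volumeReal_ball_inter_le (hball 0) hslab y
    have hc := two_mul_abs_volumeReal_inter_sub_le hA measurableSet_ball (μ := volume)
      (by simp [hvol]) (measure_ball_lt_top (x := y) (r := r)).ne (hA1.trans (hball y).symm)
      {x | 0 < x i}
    rw [← ha] at hy hc
    have h1 : |y i| * s ≤ D * a * s := mul_le_mul_of_nonneg_right hy hs
    have h2 : a ≤ a * (r⁻¹ / 2 * D) := le_mul_of_one_le_right ha0 hrD1
    calc |1 / 2 - volume.real (A ∩ {x | 0 < x i})|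
        ≤ |1 / 2 - volume.real (ball y r ∩ {x | 0 < x i})| +
          |volume.real (ball y r ∩ {x | 0 < x i}) - volume.real (A ∩ {x | 0 < x i})| :=
          abs_sub_le _ _ _
      _ ≤ D * a * s + a * (r⁻¹ / 2 * D) := by
          rw [abs_sub_comm (volume.real (ball y r ∩ _))]
          linarith
      _ = a * ((s + r⁻¹ / 2) * D) := by ring

lemma omegaB_pos (N : ℕ) : 0 < omegaB N :=
  ENNReal.toReal_pos (measure_ball_pos _ _ one_pos).ne' measure_ball_lt_top.ne

lemma two_mul_le_of_volume_eq_one {N : ℕ} (hN : 0 < N) {A : Set (En N)} (hA : MeasurableSet A)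
    (hvol : volume A = 1) {D : ℝ} (hD0 : 0 ≤ D) (hD : ∀ x ∈ A, ∀ y ∈ A, dist x y ≤ D) {r : ℝ}
    (hball : volume.real (ball (0 : En N) r) = 1) : 2 * r ≤ D := by
  by_contra! hlt
  have hr : 0 < r := by linarith
  have h1 := volume_le_volume_closedBall_half_diam hA hD0 hD
  have : Nontrivial (En N) := by
    have : Nonempty (Fin N) := ⟨⟨0, hN⟩⟩
    infer_instance
  rw [hvol, Measure.addHaar_closedBall _ _ (by positivity), finrank_euclideanSpace_fin] at h1
  have h2 := ENNReal.toReal_mono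
    (ENNReal.mul_ne_top ENNReal.ofReal_ne_top measure_ball_lt_top.ne) h1
  rw [ENNReal.toReal_mul, ENNReal.toReal_ofReal (by positivity), ENNReal.toReal_one] at h2
  rw [volumeReal_ball_eq _ hr] at hball
  have h3 : (D / 2) ^ N < r ^ N := pow_lt_pow_left₀ (by linarith) (by positivity) hN.ne'
  have h4 := mul_lt_mul_of_pos_right h3 (omegaB_pos N)
  rw [hball] at h4
  exact absurd h2 (not_le.2 h4)

/-- Assuming the sharp quantitative isoperimetric inequality, a unit-volume
set with barycenter at the origin and essential diameter at most `D` satisfies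
`|1/2 - |E ∩ {x₁>0}|| ≤ C₁ D √δ(E)` with `C₁ = C_F(N)(ω_{N-1}/ω_N^{(N-1)/N} + ω_N^{1/N}/2)`. -/
theorem halfspace_volume_est {N : ℕ} (hN : 0 < N) (CF : ℝ)
    (hQ : ∀ F : Set (En N), MeasurableSet F → HasFinitePerimeter F →
      0 < volume F → volume F ≠ ⊤ → fraenkel F ≤ CF * Real.sqrt (deficit F))
    (E : Set (En N)) (hmeas : MeasurableSet E) (hfp : HasFinitePerimeter E)
    (hEb : Bornology.IsBounded E) (hvol : volume E = 1)
    (hbar : (∫ x in E, x) = (0 : En N))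
    (D : ℝ) (hdiam : essDiam E ≤ ENNReal.ofReal D) :
    |1/2 - (volume (E ∩ {x : En N | 0 < x ⟨0, hN⟩})).toReal|
      ≤ CF * (omegaB (N - 1) / (omegaB N) ^ (((N : ℝ) - 1) / N) + (omegaB N) ^ ((1 : ℝ) / N) / 2)
        * D * Real.sqrt (deficit E) := by
  obtain ⟨n, rfl⟩ : ∃ n, N = n + 1 := ⟨N - 1, by omega⟩
  have hω := omegaB_pos (n + 1)
  have hn : ((n + 1 : ℕ) : ℝ) ≠ 0 := by positivity
  set r := ballRad E with hr_def
  have hr_eq : r = (omegaB (n + 1))⁻¹ ^ (1 / ((n + 1 : ℕ) : ℝ)) := by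
    simp [hr_def, ballRad, hvol]
  have hr : 0 < r := by
    rw [hr_eq]
    positivity
  have hrpow : r ^ (n + 1) = (omegaB (n + 1))⁻¹ := by
    rw [hr_eq, ← Real.rpow_natCast, ← Real.rpow_mul (by positivity), one_div_mul_cancel hn,
      Real.rpow_one]
  have hball : ∀ y : En (n + 1), volume.real (ball y r) = 1 := fun y => by
    rw [volumeReal_ball_eq y hr, hrpow, inv_mul_cancel₀ hω.ne']
  have hrinv : omegaB (n + 1) ^ ((1 : ℝ) / ((n + 1 : ℕ) : ℝ)) = r⁻¹ := by
    rw [hr_eq, Real.inv_rpow hω.le, inv_inv]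
  have hsection : omegaB (n + 1 - 1) /
      omegaB (n + 1) ^ ((((n + 1 : ℕ) : ℝ) - 1) / ((n + 1 : ℕ) : ℝ)) = r ^ n * omegaB n := by
    have : (((n + 1 : ℕ) : ℝ) - 1) / ((n + 1 : ℕ) : ℝ) = 1 / ((n + 1 : ℕ) : ℝ) * (n : ℝ) := by
      push_cast
      ring
    rw [this, Real.rpow_mul hω.le, hrinv, Real.rpow_natCast, inv_pow, div_inv_eq_mul, mul_comm,
      Nat.add_sub_cancel]
  obtain ⟨A, hA, hAE, hAD⟩ := exists_ae_eq_edist_le_essDiam hmeas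
  have hAvol : volume A = 1 := (measure_congr hAE).trans hvol
  have hAbar : ∫ x in A, x = (0 : En (n + 1)) := (setIntegral_congr_set hAE).trans hbar
  have hAD' : ∀ x ∈ A, ∀ y ∈ A, dist x y ≤ max D 0 := fun x hx y hy => by
    have := (hAD x hx y hy).trans hdiam
    rw [edist_dist] at this
    exact (ENNReal.ofReal_le_ofReal_iff' .. |>.1 this).elim
      (fun h => h.trans (le_max_left _ _)) (fun h => h.trans (le_max_right _ _))
  have hrD := two_mul_le_of_volume_eq_one hN hA hAvol (le_max_right D 0) hAD' (hball 0)
  have hD : max D 0 = D := by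
    refine max_eq_left (le_of_not_gt fun h => ?_)
    rw [max_eq_right h.le] at hrD
    linarith
  rw [hD] at hrD hAD'
  have hest : ∀ y, |1 / 2 - volume.real (E ∩ {x : En (n + 1) | 0 < x ⟨0, hN⟩})|
      ≤ volume.real (symmDiff E (ball y r)) * ((r ^ n * omegaB n + r⁻¹ / 2) * D) := fun y => by
    rw [← measureReal_congr (hAE.symmDiff (ae_eq_refl (ball y r))),
      ← measureReal_congr (hAE.inter (ae_eq_refl {x : En (n + 1) | 0 < x ⟨0, hN⟩}))]
    exact abs_half_sub_le_mul_volumeReal_symmDiff hA hAvol hAbar hAD' hr hrD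
      (mul_nonneg (by positivity) (omegaB_pos n).le) hball
      (fun c hc => volumeReal_ball_inter_slab_le hr hc) y
  rw [hsection, hrinv]
  have hD0 : 0 < D := by linarith
  have hK : 0 < (r ^ n * omegaB n + r⁻¹ / 2) * D := by
    have := omegaB_pos n
    positivity
  have hle : |1 / 2 - volume.real (E ∩ {x : En (n + 1) | 0 < x ⟨0, hN⟩})| /
      ((r ^ n * omegaB n + r⁻¹ / 2) * D) ≤ fraenkel E := le_ciInf fun y => by
    rw [hvol, ENNReal.toReal_one, div_one, div_le_iff₀ hK]
    exact hest y
  have hfr := hQ E hmeas hfp (by simp [hvol]) (by simp [hvol])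
  have := (div_le_iff₀ hK).1 (hle.trans hfr)
  refine this.trans_eq ?_
  ring
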